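/- (Prömel–Steger) Let F be a 2-graph and let t be the maximum integer for which there exists s with 0 ≤ s ≤ t such that the vertex set of F cannot be partitioned into s cliques and t-s independent sets (cliques and independent sets with respect to F). Then c(1/2,{F}) = 1/t; equivalently, the number of 2-graphs on vertex set {1,…,n} containing no induced subgraph isomorphic to F equals 2^{(1-1/t+o(1))·C(n,2)} as n → ∞. -/

import Mathlib

open Finset

/-- The set of all potential edges of an `r`-uniform hypergraph on vertex set `Fin n`:
the `r`-element subsets of the vertex set. -/
def edgeUniv (r n : ℕ) : Finset (Finset (Fin n)) := Finset.powersetCard r Finset.univ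

/-- `G` is an `r`-uniform hypergraph on `Fin n`: a set of `r`-element subsets of the vertices. -/
def IsRGraph (r n : ℕ) (G : Finset (Finset (Fin n))) : Prop := G ⊆ edgeUniv r n

/-- The probability that the random `r`-graph `G(n,p)` (each `r`-set being an edge
independently with probability `p`) belongs to the collection `A`. -/
noncomputable def prG (r n : ℕ) (p : ℝ) (A : Set (Finset (Finset (Fin n)))) : ℝ :=
  ∑ E ∈ (edgeUniv r n).powerset,
    Set.indicator A (fun E => p ^ E.card * (1 - p) ^ ((edgeUniv r n).card - E.card)) E

/-- The `r`-graph `F` on `Fin k` appears as an induced subgraph of `G` (an `r`-graph on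
`Fin n`) on the vertex subset `U`. -/
def IsInducedCopyAt (r k n : ℕ) (F : Finset (Finset (Fin k)))
    (G : Finset (Finset (Fin n))) (U : Finset (Fin n)) : Prop :=
  ∃ f : Fin k ↪ Fin n, Finset.univ.map f = U ∧
    ∀ e : Finset (Fin k), e.card = r → (e ∈ F ↔ e.map f ∈ G)

/-- `G` has an induced subgraph on the vertex subset `U` isomorphic to a member of the
family `Fam` (where `Fam k` is the set of members of the family on `k` vertices). -/
def HasCopyAt (r n : ℕ) (Fam : ∀ k, Set (Finset (Finset (Fin k))))
    (G : Finset (Finset (Fin n))) (U : Finset (Fin n)) : Prop :=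
  ∃ k, ∃ H ∈ Fam k, IsInducedCopyAt r k n H G U

/-- `Forb(Fam)ⁿ` : the `r`-graphs on `n` vertices with no induced subgraph isomorphic to a
member of `Fam`. -/
def ForbN (r : ℕ) (Fam : ∀ k, Set (Finset (Finset (Fin k)))) (n : ℕ) :
    Set (Finset (Finset (Fin n))) :=
  {G | IsRGraph r n G ∧ ∀ U, ¬ HasCopyAt r n Fam G U}

/-- A partial Steiner system with parameters `(r,m,n)`: a collection of `m`-element
subsets of `Fin n` such that every `r`-element subset is contained in at most one member. -/
def IsSteiner (r m n : ℕ) (D : Finset (Finset (Fin n))) : Prop :=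
  (∀ B ∈ D, B.card = m) ∧
  ∀ e : Finset (Fin n), e.card = r →
    ∀ B₁ ∈ D, ∀ B₂ ∈ D, e ⊆ B₁ → e ⊆ B₂ → B₁ = B₂

/-- `S` is a clique of the `2`-graph `F`. -/
def IsCliqueIn (v : ℕ) (F : Finset (Finset (Fin v))) (S : Finset (Fin v)) : Prop :=
  ∀ x ∈ S, ∀ y ∈ S, x ≠ y → ({x, y} : Finset (Fin v)) ∈ F

/-- `S` is an independent set of the `2`-graph `F`. -/
def IsIndepIn (v : ℕ) (F : Finset (Finset (Fin v))) (S : Finset (Fin v)) : Prop :=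
  ∀ x ∈ S, ∀ y ∈ S, x ≠ y → ({x, y} : Finset (Fin v)) ∉ F

/-- The vertex set of `F` can be partitioned into `s` cliques and `t - s` independent
sets. -/
def CanPart (v : ℕ) (F : Finset (Finset (Fin v))) (s t : ℕ) : Prop :=
  s ≤ t ∧ ∃ P : Fin t → Finset (Fin v),
    (∀ x : Fin v, ∃! i : Fin t, x ∈ P i) ∧
    (∀ i : Fin t, (i : ℕ) < s → IsCliqueIn v F (P i)) ∧
    (∀ i : Fin t, s ≤ (i : ℕ) → IsIndepIn v F (P i))


theorem ramsey_aux : ∀ m a b : ℕ, a + b ≤ m → ∃ N : ℕ, ∀ (ι : Type) (r : ι → ι → Prop), (∀ x y, r x y → r y x) →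
    ∀ S : Finset ι, N ≤ S.card →
      (∃ T ⊆ S, T.card = a ∧ ∀ x ∈ T, ∀ y ∈ T, x ≠ y → r x y) ∨
      (∃ T ⊆ S, T.card = b ∧ ∀ x ∈ T, ∀ y ∈ T, x ≠ y → ¬ r x y) := by
  classical
  intro m
  induction m with
  | zero =>
    intro a b h
    refine ⟨0, fun ι r hr S _ => Or.inl ⟨∅, by simp, by simp; omega, by simp⟩⟩
  | succ m ih =>
    intro a b h
    rcases Nat.eq_zero_or_pos a with rfl | ha
    · exact ⟨0, fun ι r hr S _ => Or.inl ⟨∅, by simp, by simp, by simp⟩⟩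
    rcases Nat.eq_zero_or_pos b with rfl | hb
    · exact ⟨0, fun ι r hr S _ => Or.inr ⟨∅, by simp, by simp, by simp⟩⟩
    obtain ⟨N1, h1⟩ := ih (a - 1) b (by omega)
    obtain ⟨N2, h2⟩ := ih a (b - 1) (by omega)
    refine ⟨N1 + N2 + 1, fun ι r hr S hS => ?_⟩
    obtain ⟨x, hx⟩ : S.Nonempty := by
      rw [← Finset.card_pos]; omega
    have hc := Finset.card_filter_add_card_filter_not (s := S.erase x) (fun y => r x y)
    rw [Finset.card_erase_of_mem hx] at hc
    by_cases hA : N1 ≤ ((S.erase x).filter (fun y => r x y)).card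
    · rcases h1 ι r hr _ hA with ⟨T, hT, hTc, hTr⟩ | ⟨T, hT, hTc, hTr⟩
      · left
        have hxT : x ∉ T := fun h => by simpa using hT h
        refine ⟨insert x T, ?_, ?_, ?_⟩
        · intro y hy
          rcases Finset.mem_insert.1 hy with rfl | hy
          · exact hx
          · exact Finset.mem_of_mem_erase (Finset.mem_filter.1 (hT hy)).1
        · rw [Finset.card_insert_of_notMem hxT]; omega
        · intro y hy z hz hyz
          rcases Finset.mem_insert.1 hy with hy' | hy' <;> rcases Finset.mem_insert.1 hz with hz' | hz'
          · exact absurd (hy'.trans hz'.symm) hyz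
          · rw [hy']
            exact (Finset.mem_filter.1 (hT hz')).2
          · rw [hz']
            exact hr _ _ (Finset.mem_filter.1 (hT hy')).2
          · exact hTr y hy' z hz' hyz
      · right
        exact ⟨T, hT.trans ((Finset.filter_subset _ _).trans (Finset.erase_subset _ _)), hTc, hTr⟩
    · have hB : N2 ≤ ((S.erase x).filter (fun y => ¬ r x y)).card := by omega
      rcases h2 ι r hr _ hB with ⟨T, hT, hTc, hTr⟩ | ⟨T, hT, hTc, hTr⟩
      · left
        exact ⟨T, hT.trans ((Finset.filter_subset _ _).trans (Finset.erase_subset _ _)), hTc, hTr⟩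
      · right
        have hxT : x ∉ T := fun h => by simpa using hT h
        refine ⟨insert x T, ?_, ?_, ?_⟩
        · intro y hy
          rcases Finset.mem_insert.1 hy with rfl | hy
          · exact hx
          · exact Finset.mem_of_mem_erase (Finset.mem_filter.1 (hT hy)).1
        · rw [Finset.card_insert_of_notMem hxT]; omega
        · intro y hy z hz hyz
          rcases Finset.mem_insert.1 hy with hy' | hy' <;> rcases Finset.mem_insert.1 hz with hz' | hz'
          · exact absurd (hy'.trans hz'.symm) hyz
          · rw [hy']
            exact (Finset.mem_filter.1 (hT hz')).2
          · rw [hz']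
            exact fun h => (Finset.mem_filter.1 (hT hy')).2 (hr _ _ h)
          · exact hTr y hy' z hz' hyz

theorem ramsey_fun (v : ℕ) : ∃ N : ℕ, ∀ (r : Fin N → Fin N → Prop), (∀ x y, r x y → r y x) →
    ∃ g : Fin v ↪ Fin N, (∀ a b, a ≠ b → r (g a) (g b)) ∨ (∀ a b, a ≠ b → ¬ r (g a) (g b)) := by
  obtain ⟨N, hN⟩ := ramsey_aux (v + v) v v le_rfl
  refine ⟨N, fun r hr => ?_⟩
  have key : ∀ T : Finset (Fin N), T.card = v → ∃ g : Fin v ↪ Fin N, ∀ a, g a ∈ T := by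
    intro T hT
    exact ⟨(T.orderEmbOfFin hT).toEmbedding, fun a => T.orderEmbOfFin_mem hT a⟩
  rcases hN (Fin N) r hr univ (by simp) with ⟨T, -, hTc, hTr⟩ | ⟨T, -, hTc, hTr⟩
  · obtain ⟨g, hg⟩ := key T hTc
    exact ⟨g, Or.inl fun a b hab => hTr _ (hg a) _ (hg b) (fun h => hab (g.injective h))⟩
  · obtain ⟨g, hg⟩ := key T hTc
    exact ⟨g, Or.inr fun a b hab => hTr _ (hg a) _ (hg b) (fun h => hab (g.injective h))⟩

/-- Total weight. -/
def totW {ι : Type} (w : ι → ι → ℝ) (S : Finset ι) : ℝ := ∑ x ∈ S, ∑ y ∈ S, w x y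

theorem totW_erase {ι : Type} [DecidableEq ι] (w : ι → ι → ℝ) (hs : ∀ x y, w x y = w y x) (h0 : ∀ x, w x x = 0)
    (S : Finset ι) (v : ι) (hv : v ∈ S) :
    totW w (S.erase v) = totW w S - 2 * ∑ y ∈ S, w v y := by
  unfold totW
  have e1 : ∀ f : ι → ℝ, ∑ y ∈ S.erase v, f y = ∑ y ∈ S, f y - f v := by
    intro f; rw [Finset.sum_erase_eq_sub hv]
  simp_rw [e1, Finset.sum_sub_distrib, h0, hs _ v]
  ring

theorem avg_subset {ι : Type} [DecidableEq ι] (w : ι → ι → ℝ) (hs : ∀ x y, w x y = w y x) (h0 : ∀ x, w x x = 0)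
    (c : ℝ) (q : ℕ) (hq : 2 ≤ q) : ∀ (k : ℕ) (S : Finset ι), S.card = q + k →
      c * (S.card * (S.card - 1)) ≤ totW w S →
      ∃ T ⊆ S, T.card = q ∧ c * (q * (q - 1)) ≤ totW w T := by
  intro k
  induction k with
  | zero => intro S hS h; refine ⟨S, Subset.rfl, by simpa using hS, ?_⟩; simpa [hS] using h
  | succ k ih =>
    intro S hS h
    have hne : S.Nonempty := by rw [← Finset.card_pos]; omega
    have hqr : (2:ℝ) ≤ q := by exact_mod_cast hq
    have hSr : (S.card : ℝ) = q + k + 1 := by rw [hS]; push_cast; ring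
    have hk : (0:ℝ) ≤ k := Nat.cast_nonneg _
    obtain ⟨v, hv, hle⟩ : ∃ v ∈ S, c * ((S.card - 1) * (S.card - 2)) ≤ totW w (S.erase v) := by
      apply Finset.exists_le_of_sum_le hne
      rw [Finset.sum_congr rfl (fun v hv => totW_erase w hs h0 S v hv)]
      have e2 : ∑ x ∈ S, 2 * ∑ y ∈ S, w x y = 2 * totW w S := by
        rw [← Finset.mul_sum]; rfl
      rw [Finset.sum_sub_distrib, e2]
      simp only [Finset.sum_const, nsmul_eq_mul]
      rw [hSr] at h ⊢
      have h4 := mul_le_mul_of_nonneg_right h (show (0:ℝ) ≤ q + k - 1 by linarith)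
      linarith
    have hc : (S.erase v).card = q + k := by rw [Finset.card_erase_of_mem hv]; omega
    obtain ⟨T, hT, h1, h2⟩ := ih (S.erase v) hc (by
      rw [hc]; push_cast; rw [hSr] at hle
      calc _ = c * (((q:ℝ) + k + 1 - 1) * (q + k + 1 - 2)) := by ring
        _ ≤ _ := hle)
    exact ⟨T, hT.trans (Finset.erase_subset _ _), h1, h2⟩

theorem min_deg_subset {ι : Type} [DecidableEq ι] (w : ι → ι → ℝ) (hs : ∀ x y, w x y = w y x) (h0 : ∀ x, w x x = 0)
    (a : ℝ) (S : Finset ι) :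
    ∃ T ⊆ S, totW w S - a * (S.card * (S.card + 1)) ≤ totW w T - a * (T.card * (T.card + 1)) ∧
      ∀ x ∈ T, a * T.card ≤ ∑ y ∈ T, w x y := by
  induction S using Finset.strongInduction with
  | H S ih =>
    by_cases h : ∀ x ∈ S, a * S.card ≤ ∑ y ∈ S, w x y
    · exact ⟨S, Subset.rfl, le_rfl, h⟩
    · push Not at h
      obtain ⟨x, hx, hlt⟩ := h
      obtain ⟨T, hT, h1, h2⟩ := ih _ (Finset.erase_ssubset hx)
      refine ⟨T, hT.trans (Finset.erase_subset _ _), le_trans ?_ h1, h2⟩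
      rw [totW_erase w hs h0 S x hx]
      have : ((S.erase x).card : ℝ) = S.card - 1 := by
        rw [Finset.card_erase_of_mem hx, Nat.cast_sub (Finset.card_pos.2 ⟨x, hx⟩)]; simp
      rw [this]
      nlinarith

theorem totW_ind {ι : Type} [DecidableEq ι] (r : ι → ι → Prop) [DecidableRel r] (S : Finset ι) :
    totW (fun x y => if r x y then (1:ℝ) else 0) S = ((S ×ˢ S).filter (fun p => r p.1 p.2)).card := by
  unfold totW
  rw [← Finset.sum_product', Finset.sum_boole]

theorem reduced_lemma (t v : ℕ) (ht : 1 ≤ t) (ε : ℝ) (hε : 0 < ε) :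
    ∃ (k0 : ℕ) (η : ℝ), 0 < η ∧ ∀ (ι : Type) (_ : DecidableEq ι) (I : Finset ι)
      (gray bad black : ι → ι → Prop) (_ : DecidableRel gray) (_ : DecidableRel bad), k0 ≤ I.card →
      (∀ x y, gray x y → gray y x) → (∀ x y, bad x y → bad y x) → (∀ x y, black x y → black y x) →
      (∀ x, ¬ gray x x) → (∀ x, ¬ bad x x) →
      (((I ×ˢ I).filter (fun p => bad p.1 p.2)).card : ℝ) ≤ η * (I.card * (I.card - 1)) →
      (1 - 1 / (t : ℝ) + ε) * (I.card : ℝ) ^ 2 ≤ (((I ×ˢ I).filter (fun p => gray p.1 p.2)).card : ℝ) →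
      ∃ g : Fin (t + 1) → Fin v → ι, (∀ i a, g i a ∈ I) ∧
        (∀ i a j b, g i a = g j b → i = j ∧ a = b) ∧
        (∀ i a j b, ¬ bad (g i a) (g j b)) ∧
        (∀ i a j b, i ≠ j → gray (g i a) (g j b)) ∧
        (∀ i, (∀ a b, a ≠ b → black (g i a) (g i b)) ∨ (∀ a b, a ≠ b → ¬ black (g i a) (g i b))) := by
  classical
  obtain ⟨L, hL⟩ := ramsey_fun v
  obtain ⟨n1, hn1⟩ := Filter.eventually_atTop.1
    (SimpleGraph.eventually_completeEquipartiteGraph_isContained_of_minDegree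
      (show 0 < ε / 4 by positivity) t L)
  have htr : (1:ℝ) ≤ t := by exact_mod_cast ht
  have hti : 1 / (t:ℝ) ≤ 1 := by rw [div_le_one (by linarith)]; exact htr
  have hti0 : 0 < 1 / (t:ℝ) := by positivity
  set b : ℝ := 1 - 1 / (t:ℝ) with hb
  have hb0 : 0 ≤ b := by linarith
  have hb1 : b ≤ 1 := by linarith
  obtain ⟨q0, hq0⟩ := exists_nat_ge (2 * (3 + ε) / ε)
  obtain ⟨q, hq⟩ : ∃ q : ℕ, q = (n1 + 1) ^ 2 + 2 + q0 := ⟨_, rfl⟩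
  have hq2 : 2 ≤ q := by rw [hq]; have := Nat.zero_le ((n1+1)^2); omega
  have hq2r : (2:ℝ) ≤ q := by exact_mod_cast hq2
  have hqn : ((n1:ℝ) + 1) ^ 2 ≤ q := by
    rw [hq]; push_cast
    have : (0:ℝ) ≤ q0 := Nat.cast_nonneg _
    linarith
  have hqe : 3 + ε ≤ ε / 2 * q := by
    have h1 : 2 * (3 + ε) / ε ≤ q := by
      refine hq0.trans ?_
      rw [hq]; push_cast; nlinarith [sq_nonneg ((n1:ℝ)+1)]
    rw [div_le_iff₀ hε] at h1
    linarith
  refine ⟨q, ε / (4 * q ^ 2), by positivity, ?_⟩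
  intro ι _ I gray bad black _ _ hk hgs hbs hbls hg0 hb0' hbad hgray
  have hIr : (q:ℝ) ≤ I.card := by exact_mod_cast hk
  set wg : ι → ι → ℝ := fun x y => if gray x y then 1 else 0 with hwg
  set wb : ι → ι → ℝ := fun x y => if bad x y then 1 else 0 with hwb
  have hwgs : ∀ x y, wg x y = wg y x := fun x y => by
    have : gray x y ↔ gray y x := ⟨hgs _ _, hgs _ _⟩
    simp [hwg, this]
  have hwbs : ∀ x y, wb x y = wb y x := fun x y => by
    have : bad x y ↔ bad y x := ⟨hbs _ _, hbs _ _⟩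
    simp [hwb, this]
  have hwg0 : ∀ x, wg x x = 0 := fun x => by simp [hwg, hg0]
  have hwb0 : ∀ x, wb x x = 0 := fun x => by simp [hwb, hb0']
  have hlin : ∀ S, totW (fun x y => wg x y - q ^ 2 * wb x y) S = totW wg S - q ^ 2 * totW wb S := by
    intro S
    simp only [totW, Finset.sum_sub_distrib, Finset.mul_sum]
  have hle : ∀ S, totW wg S ≤ (S.card : ℝ) ^ 2 := by
    intro S
    rw [hwg, totW_ind]
    have := Finset.card_filter_le (S ×ˢ S) (fun p => gray p.1 p.2)
    rw [Finset.card_product] at this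
    calc _ ≤ ((S.card * S.card : ℕ) : ℝ) := by exact_mod_cast this
      _ = _ := by push_cast; ring
  obtain ⟨T, hTI, hTc, hTw⟩ := avg_subset (fun x y => wg x y - q ^ 2 * wb x y)
    (fun x y => by simp only [hwgs x y, hwbs x y]) (fun x => by simp only [hwg0, hwb0]; ring)
    (b + 3 * ε / 4) q hq2 (I.card - q) I (by omega) (by
      rw [hlin, hwg, hwb, totW_ind, totW_ind]
      have h1 : (q:ℝ) ^ 2 * ((I ×ˢ I).filter (fun p => bad p.1 p.2)).card ≤
          ε / 4 * (I.card * (I.card - 1)) := by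
        calc _ ≤ (q:ℝ) ^ 2 * (ε / (4 * q ^ 2) * (I.card * (I.card - 1))) := by gcongr
          _ = _ := by field_simp
      have h2 : (b + ε) * ((I.card : ℝ) * (I.card - 1)) ≤ (b + ε) * (I.card : ℝ) ^ 2 := by
        apply mul_le_mul_of_nonneg_left _ (by linarith)
        nlinarith
      nlinarith)
  rw [hlin] at hTw
  have hTpos : 0 < totW wg T - q ^ 2 * totW wb T :=
    lt_of_lt_of_le (mul_pos (by linarith) (mul_pos (by linarith) (by linarith))) hTw
  have hTle := hle T
  rw [hTc] at hTle
  have hnobad : ∀ x ∈ T, ∀ y ∈ T, ¬ bad x y := by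
    intro x hx y hy hxy
    have : (1:ℝ) ≤ totW wb T := by
      rw [hwb, totW_ind]
      have : 0 < ((T ×ˢ T).filter (fun p => bad p.1 p.2)).card :=
        Finset.card_pos.2 ⟨(x, y), by simp [hx, hy, hxy]⟩
      exact_mod_cast this
    have h3 : (q:ℝ) ^ 2 * 1 ≤ q ^ 2 * totW wb T := by gcongr
    linarith
  have hwbT : 0 ≤ totW wb T := by rw [hwb, totW_ind]; positivity
  have hgT : (b + 3 * ε / 4) * (q * (q - 1)) ≤ totW wg T := by
    have : 0 ≤ (q:ℝ) ^ 2 * totW wb T := by positivity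
    linarith
  obtain ⟨T', hT'T, hpsi, hdeg⟩ := min_deg_subset wg hwgs hwg0 (b + ε / 4) T
  rw [hTc] at hpsi
  have hT'c : n1 + 1 ≤ T'.card := by
    have h1 : ((n1:ℝ) + 1) ^ 2 ≤ (T'.card : ℝ) ^ 2 := by
      have h2 := hle T'
      have h3 : 0 ≤ (b + ε / 4) * ((T'.card : ℝ) * (T'.card + 1)) := by positivity
      have h4 : (q:ℝ) * 1 ≤ q * (ε / 2 * q - (2 + ε)) := by gcongr; linarith
      have h5 : b * q ≤ 1 * q := by gcongr
      nlinarith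
    have h2 := abs_le_of_sq_le_sq' h1 (by positivity)
    exact_mod_cast h2.2
  obtain ⟨m, hm⟩ : ∃ m, m = T'.card := ⟨_, rfl⟩
  let e : T' ≃ Fin m := T'.equivFinOfCardEq hm.symm
  let H : SimpleGraph (Fin m) :=
    { Adj := fun i j => gray (e.symm i) (e.symm j)
      symm := ⟨fun i j h => hgs _ _ h⟩
      loopless := ⟨fun i h => hg0 _ h⟩ }
  have hne : Nonempty (Fin m) := ⟨⟨0, by omega⟩⟩
  have hdegH : ∀ i, (b + ε / 4) * m ≤ H.degree i := by
    intro i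
    have h1 := hdeg (e.symm i) (e.symm i).2
    rw [← hm] at h1
    refine h1.trans (le_of_eq ?_)
    rw [← SimpleGraph.card_neighborFinset_eq_degree, SimpleGraph.neighborFinset_eq_filter]
    rw [← Finset.sum_coe_sort T' (fun y => wg (↑(e.symm i)) y)]
    rw [← e.symm.sum_comp]
    simp only [hwg, Finset.sum_boole]
    rfl
  obtain ⟨⟨f, hf⟩⟩ := hn1 m (by omega) (G := H) (by
    obtain ⟨i, hi⟩ := H.exists_minimal_degree_vertex
    rw [hi]; exact hdegH i)
  have hR : ∀ i : Fin (t + 1), ∃ g : Fin v ↪ Fin L,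
      (∀ a b, a ≠ b → black (e.symm (f (i, g a))) (e.symm (f (i, g b)))) ∨
      (∀ a b, a ≠ b → ¬ black (e.symm (f (i, g a))) (e.symm (f (i, g b)))) := fun i =>
    hL (fun x y => black (e.symm (f (i, x))) (e.symm (f (i, y)))) (fun x y h => hbls _ _ h)
  choose g hg using hR
  have hmem : ∀ i a, ((e.symm (f (i, g i a)) : T') : ι) ∈ T' := fun i a => (e.symm _).2
  refine ⟨fun i a => e.symm (f (i, g i a)), fun i a => hTI (hT'T (hmem i a)), ?_,
    fun i a j b => hnobad _ (hT'T (hmem i a)) _ (hT'T (hmem j b)), ?_, hg⟩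
  · intro i a j b h
    have h1 := hf (e.symm.injective (Subtype.ext h))
    simp only [Prod.mk.injEq] at h1
    obtain ⟨rfl, h2⟩ := h1
    exact ⟨rfl, (g i).injective h2⟩
  · intro i a j b hij
    exact f.map_rel (a := (i, g i a)) (b := (j, g j b)) (by simpa using hij)

theorem embed_lemma (δ : ℝ) (hδ : 0 < δ) : ∀ v : ℕ, ∃ η : ℝ, 0 < η ∧ ∀ (V : Type)
    (C : Fin v → Finset V) (R : Fin v → Fin v → V → V → Prop)
    (_ : ∀ i j x y, Decidable (R i j x y)), (∀ i, (C i).Nonempty) →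
    (∀ i j, i < j → ∀ X ⊆ C i, ∀ Y ⊆ C j, η * (C i).card ≤ X.card → η * (C j).card ≤ Y.card →
      δ * (X.card * Y.card) ≤ ((X ×ˢ Y).filter (fun p => R i j p.1 p.2)).card) →
    ∃ x : Fin v → V, (∀ i, x i ∈ C i) ∧ ∀ i j, i < j → R i j (x i) (x j) := by
  intro v
  induction v with
  | zero =>
    refine ⟨1, one_pos, fun V C R _ hC hR => ⟨fun i => i.elim0, fun i => i.elim0, fun i => i.elim0⟩⟩
  | succ v ih =>
    obtain ⟨η', hη', H⟩ := ih
    obtain ⟨η, hη⟩ : ∃ η : ℝ, η = min (η' * δ) (1 / ((v:ℝ) + 1)) := ⟨_, rfl⟩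
    have hη0 : 0 < η := by rw [hη]; positivity
    have hη1 : η ≤ η' * δ := by rw [hη]; exact min_le_left _ _
    have hη2 : η ≤ 1 / ((v:ℝ) + 1) := by rw [hη]; exact min_le_right _ _
    have hη3 : η * (v + 1) ≤ 1 := by rwa [le_div_iff₀ (by positivity)] at hη2
    have hη4 : η ≤ 1 := by
      have : (0:ℝ) ≤ η * v := by positivity
      linarith
    refine ⟨η, hη0, fun V C R _ hC hR => ?_⟩
    classical
    let B : Fin v → Finset V := fun j => (C 0).filter (fun x =>
      (((C j.succ).filter (fun y => R 0 j.succ x y)).card : ℝ) < δ * (C j.succ).card)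
    have hC0 : (0:ℝ) < (C 0).card := by exact_mod_cast (hC 0).card_pos
    have hB : ∀ j, ((B j).card : ℝ) ≤ η * (C 0).card := by
      intro j
      by_contra hcon
      push Not at hcon
      have hCj : (0:ℝ) < (C j.succ).card := by exact_mod_cast (hC j.succ).card_pos
      have h1 := hR 0 j.succ (Fin.succ_pos j) (B j) (Finset.filter_subset _ _) (C j.succ) subset_rfl
        hcon.le (by nlinarith)
      have hBpos : (0:ℝ) < (B j).card := lt_trans (by positivity) hcon
      have hBne : (B j).Nonempty := by rw [← Finset.card_pos]; exact_mod_cast hBpos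
      have h2 : (((B j ×ˢ C j.succ).filter (fun p => R 0 j.succ p.1 p.2)).card : ℝ) =
          ∑ x ∈ B j, (((C j.succ).filter (fun y => R 0 j.succ x y)).card : ℝ) := by
        simp_rw [Finset.natCast_card_filter]
        rw [Finset.sum_product]
      have h3 : ∑ x ∈ B j, (((C j.succ).filter (fun y => R 0 j.succ x y)).card : ℝ) <
          ∑ x ∈ B j, δ * (C j.succ).card :=
        Finset.sum_lt_sum_of_nonempty hBne (fun x hx => (Finset.mem_filter.1 hx).2)
      rw [Finset.sum_const, nsmul_eq_mul] at h3
      nlinarith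
    obtain ⟨x, hx, hxB⟩ : ∃ x ∈ C 0, x ∉ Finset.univ.biUnion B := by
      by_contra hcon
      push Not at hcon
      have h1 : (C 0).card ≤ ∑ j, (B j).card :=
        (Finset.card_le_card hcon).trans Finset.card_biUnion_le
      have h2 : ((C 0).card : ℝ) ≤ ∑ j, ((B j).card : ℝ) := by exact_mod_cast h1
      have h3 : ∑ j, ((B j).card : ℝ) ≤ ∑ j : Fin v, η * (C 0).card := Finset.sum_le_sum (fun j _ => hB j)
      simp only [Finset.sum_const, nsmul_eq_mul, Finset.card_univ, Fintype.card_fin] at h3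
      have h4 : 0 < η * (C 0).card := by positivity
      nlinarith
    have hxB' : ∀ j : Fin v, δ * (C j.succ).card ≤ ((C j.succ).filter (fun y => R 0 j.succ x y)).card := by
      intro j
      by_contra hcon
      push Not at hcon
      exact hxB (Finset.mem_biUnion.2 ⟨j, Finset.mem_univ _, Finset.mem_filter.2 ⟨hx, hcon⟩⟩)
    obtain ⟨y, hy, hyR⟩ := H V (fun j => (C j.succ).filter (fun y => R 0 j.succ x y))
      (fun i j => R i.succ j.succ) inferInstance (by
        intro j
        have h1 : (0:ℝ) < (C j.succ).card := by exact_mod_cast (hC j.succ).card_pos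
        have h2 := lt_of_lt_of_le (by positivity) (hxB' j)
        rw [← Finset.card_pos]
        exact_mod_cast h2)
      (by
        intro i j hij X hX Y hY hXc hYc
        have aux : ∀ j : Fin v, ∀ Y : Finset V, η' * ((C j.succ).filter (fun y => R 0 j.succ x y)).card ≤ Y.card →
            η * (C j.succ).card ≤ Y.card := by
          intro j Y h
          have h1 := hxB' j
          calc η * (C j.succ).card ≤ η' * δ * (C j.succ).card := by gcongr
            _ = η' * (δ * (C j.succ).card) := by ring
            _ ≤ _ := by gcongr
            _ ≤ _ := h
        exact hR i.succ j.succ (Fin.succ_lt_succ_iff.2 hij) X (hX.trans (Finset.filter_subset _ _))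
          Y (hY.trans (Finset.filter_subset _ _)) (aux i X hXc) (aux j Y hYc))
    refine ⟨Fin.cons x y, ?_, ?_⟩
    · intro i
      refine Fin.cases ?_ (fun i => ?_) i
      · simpa using hx
      · simpa using (Finset.mem_filter.1 (hy i)).1
    · intro i j
      refine Fin.cases ?_ (fun i => ?_) i
      · refine Fin.cases ?_ (fun j => ?_) j
        · intro h; exact absurd h (lt_irrefl _)
        · intro _; simpa using (Finset.mem_filter.1 (hy j)).2
      · refine Fin.cases ?_ (fun j => ?_) j
        · intro h; exact absurd h (by simp)
        · intro h; simpa using hyR i j (Fin.succ_lt_succ_iff.1 h)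

/-- The simple graph associated with a `2`-graph. -/
def sg {n : ℕ} (G : Finset (Finset (Fin n))) : SimpleGraph (Fin n) where
  Adj x y := x ≠ y ∧ ({x, y} : Finset (Fin n)) ∈ G
  symm := ⟨fun x y h => ⟨h.1.symm, by rw [Finset.pair_comm]; exact h.2⟩⟩
  loopless := ⟨fun x h => h.1 rfl⟩

instance {n : ℕ} (G : Finset (Finset (Fin n))) : DecidableRel (sg G).Adj := fun x y => by
  unfold sg; infer_instance

theorem part_perm (v : ℕ) (F : Finset (Finset (Fin v))) (T : ℕ)
    (h : ∀ s ≤ T, CanPart v F s T) (b : Fin T → Prop) :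
    ∃ π : Fin v → Fin T, ∀ x y, x ≠ y → π x = π y →
      (b (π x) → ({x, y} : Finset (Fin v)) ∈ F) ∧ (¬ b (π x) → ({x, y} : Finset (Fin v)) ∉ F) := by
  classical
  obtain ⟨s, hs⟩ : ∃ s, s = (Finset.univ.filter b).card := ⟨_, rfl⟩
  have hsT : s ≤ T := by
    rw [hs]; exact (Finset.card_le_univ _).trans (by simp)
  obtain ⟨-, P, hP1, hP2, hP3⟩ := h s hsT
  have hc : Fintype.card {i : Fin T // (i : ℕ) < s} = Fintype.card {i : Fin T // b i} := by
    rw [Fintype.card_subtype b, ← hs, Fintype.card_subtype]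
    simp [Fin.card_filter_val_lt, hsT]
  let e := Fintype.equivOfCardEq hc
  let σ := e.extendSubtype
  choose p hp hpu using hP1
  refine ⟨fun x => σ (p x), fun x y hxy hpi => ?_⟩
  have hpxy : p x = p y := σ.injective hpi
  by_cases hlt : (p x : ℕ) < s
  · have hb : b (σ (p x)) := e.extendSubtype_mem _ hlt
    exact ⟨fun _ => hP2 (p x) hlt x (hp x) y (hpxy ▸ hp y) hxy, fun h => absurd hb h⟩
  · have hb : ¬ b (σ (p x)) := e.extendSubtype_not_mem _ hlt
    exact ⟨fun h => absurd h hb, fun _ => hP3 (p x) (not_lt.1 hlt) x (hp x) y (hpxy ▸ hp y) hxy⟩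

theorem dens_aux {n : ℕ} (H : SimpleGraph (Fin n)) [DecidableRel H.Adj] (X Y : Finset (Fin n)) :
    (((X ×ˢ Y).filter (fun p => H.Adj p.1 p.2)).card : ℝ) = (H.edgeDensity X Y : ℝ) * (X.card * Y.card) := by
  have h1 : ((X ×ˢ Y).filter (fun p => H.Adj p.1 p.2)) = H.interedges X Y := by
    ext p; simp [SimpleGraph.interedges, Rel.interedges]
  rw [h1, SimpleGraph.edgeDensity_def]
  rcases X.eq_empty_or_nonempty with rfl | hX
  · simp
  rcases Y.eq_empty_or_nonempty with rfl | hY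
  · simp [← h1]
  have h2 : (0:ℝ) < X.card := by exact_mod_cast hX.card_pos
  have h3 : (0:ℝ) < Y.card := by exact_mod_cast hY.card_pos
  push_cast
  field_simp

theorem copy_lemma (v : ℕ) (F : Finset (Finset (Fin v))) (t : ℕ)
    (h : ∀ s ≤ t + 1, CanPart v F s (t + 1)) (δ : ℝ) (hδ : 0 < δ) (hδ1 : δ ≤ 1 / 2) :
    ∃ η : ℝ, 0 < η ∧ ∀ (n : ℕ) (G : Finset (Finset (Fin n))) (ε : ℝ)
      (g : Fin (t + 1) → Fin v → Finset (Fin n)), ε ≤ η →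
      (∀ i a, (g i a).Nonempty) →
      (∀ i a j b, (i, a) ≠ (j, b) → Disjoint (g i a) (g j b)) →
      (∀ i a j b, (i, a) ≠ (j, b) → (sg G).IsUniform ε (g i a) (g j b)) →
      (∀ i a j b, i ≠ j → δ ≤ ((sg G).edgeDensity (g i a) (g j b) : ℝ) ∧
        ((sg G).edgeDensity (g i a) (g j b) : ℝ) ≤ 1 - δ) →
      (∀ i, (∀ a b, a ≠ b → 1 / 2 ≤ ((sg G).edgeDensity (g i a) (g i b) : ℝ)) ∨
        (∀ a b, a ≠ b → ¬ 1 / 2 ≤ ((sg G).edgeDensity (g i a) (g i b) : ℝ))) →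
      ∃ U, IsInducedCopyAt 2 v n F G U := by
  classical
  obtain ⟨η, hη, H⟩ := embed_lemma (δ / 2) (by linarith) v
  refine ⟨min η (δ / 2), lt_min hη (by linarith), ?_⟩
  intro n G ε g hε hne hdis hunif hdens hblack
  have hε1 := hε.trans (min_le_left _ _)
  have hε2 := hε.trans (min_le_right _ _)
  obtain ⟨π, hπ⟩ := part_perm v F (t + 1) h
    (fun i => ∀ a b, a ≠ b → 1 / 2 ≤ ((sg G).edgeDensity (g i a) (g i b) : ℝ))
  have hne' : ∀ i j : Fin v, i ≠ j → (π i, i) ≠ (π j, j) := fun i j hij h => hij (Prod.mk.inj h).2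
  obtain ⟨x, hxC, hxR⟩ := H (Fin n) (fun a => g (π a) a)
    (fun a b x y => if ({a, b} : Finset (Fin v)) ∈ F then (sg G).Adj x y else ¬ (sg G).Adj x y)
    inferInstance (fun a => hne _ _) (by
      intro i j hij X hX Y hY hXc hYc
      have hij' := hij.ne
      have hu := hunif (π i) i (π j) j (hne' i j hij')
      have hX' : ((g (π i) i).card : ℝ) * ε ≤ X.card := by
        refine le_trans ?_ hXc
        rw [mul_comm]; gcongr
      have hY' : ((g (π j) j).card : ℝ) * ε ≤ Y.card := by
        refine le_trans ?_ hYc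
        rw [mul_comm]; gcongr
      have habs := abs_lt.1 (hu hX hY hX' hY')
      have hbig : ({i, j} : Finset (Fin v)) ∈ F → δ ≤ ((sg G).edgeDensity (g (π i) i) (g (π j) j) : ℝ) := by
        intro hF
        by_cases hp : π i = π j
        · have h1 := (hπ i j hij' hp)
          rcases hblack (π i) with hb | hb
          · have := hb i j hij'
            rw [← hp]; linarith
          · exfalso
            refine h1.2 (fun hcon => hb i j hij' (hcon i j hij')) hF
        · exact (hdens _ _ _ _ hp).1
      have hsmall : ({i, j} : Finset (Fin v)) ∉ F → ((sg G).edgeDensity (g (π i) i) (g (π j) j) : ℝ) ≤ 1 - δ := by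
        intro hF
        by_cases hp : π i = π j
        · have h1 := (hπ i j hij' hp)
          rcases hblack (π i) with hb | hb
          · exact absurd (h1.1 hb) hF
          · have := hb i j hij'
            rw [← hp]; linarith
        · exact (hdens _ _ _ _ hp).2
      by_cases hF : ({i, j} : Finset (Fin v)) ∈ F
      · simp only [hF, if_true]
        rw [dens_aux]
        have := hbig hF
        gcongr
        linarith
      · simp only [hF, if_false]
        have h1 := Finset.card_filter_add_card_filter_not (s := X ×ˢ Y) (fun p => (sg G).Adj p.1 p.2)
        rw [Finset.card_product] at h1
        have h2 : (((X ×ˢ Y).filter (fun p => (sg G).Adj p.1 p.2)).card : ℝ) +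
          ((X ×ˢ Y).filter (fun p => ¬ (sg G).Adj p.1 p.2)).card = X.card * Y.card := by
          exact_mod_cast h1
        rw [dens_aux] at h2
        have h3 := hsmall hF
        have h4 : ((sg G).edgeDensity X Y : ℝ) * (X.card * Y.card) ≤ (1 - δ / 2) * (X.card * Y.card) := by
          gcongr
          linarith
        linarith)
  have hinj : Function.Injective x := by
    intro a b hab
    by_contra hne2
    exact Finset.disjoint_left.1 (hdis _ _ _ _ (hne' a b hne2)) (hxC a) (hab ▸ hxC b)
  have hkey : ∀ a b, a < b → (({a, b} : Finset (Fin v)) ∈ F ↔ ({x a, x b} : Finset (Fin n)) ∈ G) := by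
    intro a b hab
    have h1 := hxR a b hab
    have h2 : x a ≠ x b := fun h => hab.ne (hinj h)
    by_cases hF : ({a, b} : Finset (Fin v)) ∈ F
    · simp only [hF, if_true] at h1
      exact ⟨fun _ => h1.2, fun _ => hF⟩
    · simp only [hF, if_false] at h1
      exact ⟨fun h => absurd h hF, fun h => absurd ⟨h2, h⟩ h1⟩
  refine ⟨_, ⟨x, hinj⟩, rfl, ?_⟩
  intro e he
  obtain ⟨a, b, hab, rfl⟩ := Finset.card_eq_two.1 he
  rw [Finset.map_insert, Finset.map_singleton]
  rcases lt_or_gt_of_ne hab with hlt | hlt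
  · exact hkey a b hlt
  · rw [Finset.pair_comm a b, hkey b a hlt, Finset.pair_comm]
    rfl

theorem structure_lemma (v : ℕ) (F : Finset (Finset (Fin v))) (t : ℕ) (ht : 1 ≤ t)
    (h : ∀ s ≤ t + 1, CanPart v F s (t + 1)) (ε : ℝ) (hε : 0 < ε) :
    ∃ K n0 : ℕ, ∀ n, n0 ≤ n → ∀ G : Finset (Finset (Fin n)),
      (∀ U, ¬ IsInducedCopyAt 2 v n F G U) →
      ∃ (p : Fin n → Fin K) (gr bl : Finset (Fin K × Fin K)),
        (∀ x y, (p x, p y) ∈ gr → (p y, p x) ∈ gr) ∧ (∀ x y, (p x, p y) ∈ bl → (p y, p x) ∈ bl) ∧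
        (∀ x, (p x, p x) ∉ gr) ∧
        ((univ.filter (fun q : Fin n × Fin n => (p q.1, p q.2) ∈ gr)).card : ℝ) ≤
          (1 - 1 / (t:ℝ) + ε) * (n:ℝ) ^ 2 ∧
        ((univ.filter (fun q : Fin n × Fin n => q.1 ≠ q.2 ∧ (p q.1, p q.2) ∉ gr ∧
          ¬ (({q.1, q.2} : Finset (Fin n)) ∈ G ↔ (p q.1, p q.2) ∈ bl))).card : ℝ) ≤ ε * (n:ℝ) ^ 2 := by
  classical
  obtain ⟨δ, hδ⟩ : ∃ δ : ℝ, δ = min (ε / 16) (1 / 4) := ⟨_, rfl⟩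
  have hδ0 : 0 < δ := by rw [hδ]; positivity
  have hδ1 : δ ≤ ε / 16 := by rw [hδ]; exact min_le_left _ _
  have hδ2 : δ ≤ 1 / 4 := by rw [hδ]; exact min_le_right _ _
  obtain ⟨η, hη, Hcopy⟩ := copy_lemma v F t h δ hδ0 (by linarith)
  obtain ⟨k0, η', hη', Hred⟩ := reduced_lemma t v ht (ε / 2) (by linarith)
  obtain ⟨εr, hεr⟩ : ∃ εr : ℝ, εr = min (min η η') (ε / 16) := ⟨_, rfl⟩
  have hr0 : 0 < εr := by rw [hεr]; positivity
  have hr1 : εr ≤ η := by rw [hεr]; exact (min_le_left _ _).trans (min_le_left _ _)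
  have hr2 : εr ≤ η' := by rw [hεr]; exact (min_le_left _ _).trans (min_le_right _ _)
  have hr3 : εr ≤ ε / 16 := by rw [hεr]; exact (min_le_right _ _)
  obtain ⟨l0, hl0⟩ := exists_nat_ge (4 / εr)
  obtain ⟨l, hl⟩ : ∃ l, l = max (max k0 l0) 1 := ⟨_, rfl⟩
  obtain ⟨K, hK⟩ : ∃ K, K = SzemerediRegularity.bound εr l := ⟨_, rfl⟩
  have hK0 : 0 < K := by rw [hK]; exact SzemerediRegularity.bound_pos _ _
  obtain ⟨m0, hm0⟩ := exists_nat_ge (6 * K * (1 + ε) / ε)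
  have htr : (1:ℝ) ≤ t := by exact_mod_cast ht
  have hti : 1 / (t:ℝ) ≤ 1 := by rw [div_le_one (by linarith)]; exact htr
  have hti0 : 0 < 1 / (t:ℝ) := by positivity
  refine ⟨K, max (max l K) m0, ?_⟩
  intro n hn G hG
  have hnl : l ≤ n := (le_max_left _ _).trans ((le_max_left _ _).trans hn)
  have hnK : K ≤ n := (le_max_right _ _).trans ((le_max_left _ _).trans hn)
  have hnm : m0 ≤ n := (le_max_right _ _).trans hn
  have hn1 : 1 ≤ n := le_trans (by rw [hl]; exact le_max_right _ _) hnl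
  obtain ⟨P, hPe, hPl, hPK, hPu⟩ := szemeredi_regularity (sg G) hr0 (l := l) (by simpa using hnl)
  rw [← hK] at hPK
  obtain ⟨k, hk⟩ : ∃ k, k = P.parts.card := ⟨_, rfl⟩
  -- the relations on parts
  let d : Finset (Fin n) → Finset (Fin n) → ℝ := fun U V => ((sg G).edgeDensity U V : ℝ)
  have hdc : ∀ U V, d U V = d V U := fun U V => by
    simp only [d]; rw [SimpleGraph.edgeDensity_comm]
  let gray : Finset (Fin n) → Finset (Fin n) → Prop := fun U V =>
    U ≠ V ∧ (sg G).IsUniform εr U V ∧ δ ≤ d U V ∧ d U V ≤ 1 - δ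
  let bad : Finset (Fin n) → Finset (Fin n) → Prop := fun U V => U ≠ V ∧ ¬ (sg G).IsUniform εr U V
  let black : Finset (Fin n) → Finset (Fin n) → Prop := fun U V => 1 / 2 ≤ d U V
  have hgs : ∀ U V, gray U V → gray V U := fun U V hh =>
    ⟨hh.1.symm, hh.2.1.symm, by rw [hdc]; exact hh.2.2.1, by rw [hdc]; exact hh.2.2.2⟩
  have hbs : ∀ U V, bad U V → bad V U := fun U V hh => ⟨hh.1.symm, fun h2 => hh.2 h2.symm⟩
  have hbls : ∀ U V, black U V → black V U := fun U V hh => by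
    simp only [black]; rw [hdc]; exact hh
  have hkl : l ≤ k := by rw [hk]; exact hPl
  have hk1 : 1 ≤ k := le_trans (by rw [hl]; exact le_max_right _ _) hkl
  have hkk0 : k0 ≤ k := le_trans (by rw [hl]; exact (le_max_left _ _).trans (le_max_left _ _)) hkl
  have hkl0 : l0 ≤ k := le_trans (by rw [hl]; exact (le_max_right _ _).trans (le_max_left _ _)) hkl
  have hbadc : (((P.parts ×ˢ P.parts).filter (fun q => bad q.1 q.2)).card : ℝ) ≤ η' * (k * (k - 1)) := by
    have h1 : (P.parts ×ˢ P.parts).filter (fun q => bad q.1 q.2) = P.nonUniforms (sg G) εr := by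
      ext ⟨U, V⟩
      simp only [Finset.mem_filter, Finset.mem_product, Finpartition.mk_mem_nonUniforms, bad]
      tauto
    rw [h1]
    refine le_trans hPu ?_
    rw [← hk, mul_comm]
    have : ((k * (k - 1) : ℕ) : ℝ) = k * (k - 1) := by
      rw [Nat.cast_mul, Nat.cast_sub hk1]; simp
    rw [this]
    have : (1:ℝ) ≤ k := by exact_mod_cast hk1
    have h3 : (0:ℝ) ≤ k * (k - 1) := mul_nonneg (by linarith) (by linarith)
    gcongr
  have hgrayc : (((P.parts ×ˢ P.parts).filter (fun q => gray q.1 q.2)).card : ℝ) ≤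
      (1 - 1 / (t : ℝ) + ε / 2) * (k : ℝ) ^ 2 := by
    by_contra hcon
    push Not at hcon
    rw [hk] at hcon hbadc hkk0
    obtain ⟨g, hgI, hginj, hgbad, hggray, hgblack⟩ := Hred _ (Classical.decEq _) P.parts gray bad black
      (Classical.decRel _) (Classical.decRel _) hkk0 hgs hbs hbls (fun U hU => hU.1 rfl)
      (fun U hU => hU.1 rfl) (by convert hbadc) (le_of_lt (by convert hcon))
    have hgne : ∀ i a j b, (i, a) ≠ (j, b) → g i a ≠ g j b := by
      intro i a j b hne he
      obtain ⟨rfl, rfl⟩ := hginj _ _ _ _ he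
      exact hne rfl
    obtain ⟨U, hU⟩ := Hcopy n G εr g hr1 (fun i a => P.nonempty_of_mem_parts (hgI i a))
      (fun i a j b hne => P.disjoint (hgI i a) (hgI j b) (hgne _ _ _ _ hne))
      (fun i a j b hne => by
        by_contra hc
        exact hgbad i a j b ⟨hgne _ _ _ _ hne, hc⟩)
      (fun i a j b hij => (hggray i a j b hij).2.2) hgblack
    exact hG U hU
  -- the encoding
  obtain ⟨idx, hidx⟩ : ∃ idx : Finset (Fin n) → Fin K, ∀ U ∈ P.parts, ∀ V ∈ P.parts, idx U = idx V → U = V := by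
    refine ⟨fun U => if hU : U ∈ P.parts then Fin.castLE hPK (P.parts.equivFin ⟨U, hU⟩) else ⟨0, hK0⟩, ?_⟩
    intro U hU V hV hUV
    simp only [hU, hV, dif_pos] at hUV
    have h1 := P.parts.equivFin.injective (Fin.castLE_injective hPK hUV)
    exact Subtype.ext_iff.1 h1
  have hpm : ∀ x, P.part x ∈ P.parts := fun x => P.part_mem.2 (mem_univ x)
  have hpx : ∀ x, x ∈ P.part x := fun x => P.mem_part_self.2 (mem_univ x)
  let enc : (Finset (Fin n) → Finset (Fin n) → Prop) → Finset (Fin K × Fin K) := fun r =>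
    univ.filter (fun q => ∃ U ∈ P.parts, ∃ V ∈ P.parts, idx U = q.1 ∧ idx V = q.2 ∧ r U V)
  have henc : ∀ r x y, (idx (P.part x), idx (P.part y)) ∈ enc r ↔ r (P.part x) (P.part y) := by
    intro r x y
    simp only [enc, Finset.mem_filter, Finset.mem_univ, true_and]
    constructor
    · rintro ⟨U, hU, V, hV, h1, h2, h3⟩
      rw [← hidx U hU _ (hpm x) h1, ← hidx V hV _ (hpm y) h2]
      exact h3
    · intro h3
      exact ⟨_, hpm x, _, hpm y, rfl, rfl, h3⟩
  refine ⟨fun x => idx (P.part x), enc gray, enc black, ?_, ?_, ?_, ?_, ?_⟩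
  · intro x y; simp only [henc]; exact hgs _ _
  · intro x y; simp only [henc]; exact hbls _ _
  · intro x; simp only [henc]; exact fun hU => hU.1 rfl
  · simp only [henc]
    have hkr : (0:ℝ) < k := by exact_mod_cast hk1
    have hsub : univ.filter (fun q : Fin n × Fin n => gray (P.part q.1) (P.part q.2)) ⊆
        ((P.parts ×ˢ P.parts).filter (fun q => gray q.1 q.2)).biUnion (fun q => q.1 ×ˢ q.2) := by
      intro q hq
      rw [Finset.mem_biUnion]
      refine ⟨(P.part q.1, P.part q.2), ?_, ?_⟩
      · simp only [Finset.mem_filter, Finset.mem_product]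
        exact ⟨⟨hpm _, hpm _⟩, (Finset.mem_filter.1 hq).2⟩
      · exact Finset.mem_product.2 ⟨hpx _, hpx _⟩
    have h1 := Finset.card_le_card hsub
    have h2 : (((P.parts ×ˢ P.parts).filter (fun q => gray q.1 q.2)).biUnion (fun q => q.1 ×ˢ q.2)).card ≤
        ((P.parts ×ˢ P.parts).filter (fun q => gray q.1 q.2)).card * (n / k + 1) ^ 2 := by
      apply Finset.card_biUnion_le_card_mul
      intro q hq
      obtain ⟨h3, h4⟩ := Finset.mem_product.1 (Finset.mem_filter.1 hq).1
      rw [Finset.card_product, sq]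
      have h5 := hPe.card_part_le_average_add_one h3
      have h6 := hPe.card_part_le_average_add_one h4
      rw [← hk, Finset.card_univ, Fintype.card_fin] at h5 h6
      exact Nat.mul_le_mul h5 h6
    have h3 : ((univ.filter (fun q : Fin n × Fin n => gray (P.part q.1) (P.part q.2))).card : ℝ) ≤
        (((P.parts ×ˢ P.parts).filter (fun q => gray q.1 q.2)).card : ℝ) * (((n / k : ℕ) : ℝ) + 1) ^ 2 := by
      exact_mod_cast h1.trans h2
    have h4 : ((n / k : ℕ) : ℝ) ≤ n / k := Nat.cast_div_le
    have hnKr : (K:ℝ) ≤ n := by exact_mod_cast hnK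
    have hkKr : (k:ℝ) ≤ K := by rw [hk]; exact_mod_cast hPK
    have hnr : 6 * K * (1 + ε) ≤ ε * n := by
      have : 6 * K * (1 + ε) / ε ≤ n := hm0.trans (by exact_mod_cast hnm)
      rw [div_le_iff₀ hε] at this
      linarith
    have h5 : (1 - 1 / (t : ℝ) + ε / 2) * (2 * n * k + k ^ 2) ≤ ε / 2 * n ^ 2 := by
      calc (1 - 1 / (t : ℝ) + ε / 2) * (2 * n * k + k ^ 2) ≤ (1 + ε) * (2 * n * K + n * K) := by
            gcongr
            · linarith
            · linarith
            · rw [sq]; gcongr; linarith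
        _ = (6 * K * (1 + ε)) * (n / 2) := by ring
        _ ≤ (ε * n) * (n / 2) := by gcongr
        _ = _ := by ring
    calc _ ≤ _ := h3
      _ ≤ ((1 - 1 / (t : ℝ) + ε / 2) * (k : ℝ) ^ 2) * ((n : ℝ) / k + 1) ^ 2 := by
          have : 0 ≤ (1 - 1 / (t : ℝ) + ε / 2) := by linarith
          gcongr
      _ = (1 - 1 / (t : ℝ) + ε / 2) * (n + k) ^ 2 := by field_simp
      _ ≤ _ := by nlinarith
  · simp only [henc]
    have hsub : univ.filter (fun q : Fin n × Fin n => q.1 ≠ q.2 ∧ ¬ gray (P.part q.1) (P.part q.2) ∧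
          ¬ (({q.1, q.2} : Finset (Fin n)) ∈ G ↔ black (P.part q.1) (P.part q.2))) ⊆
        (P.parts.biUnion offDiag) ∪ ((P.nonUniforms (sg G) εr).biUnion fun q => q.1 ×ˢ q.2) ∪
        ((P.sparsePairs (sg G) δ).biUnion fun q => (sg G).interedges q.1 q.2) ∪
        ((P.sparsePairs (sg G)ᶜ δ).biUnion fun q => (sg G)ᶜ.interedges q.1 q.2) := by
      rintro ⟨x, y⟩ hq
      obtain ⟨hxy, hng, hbl⟩ := (Finset.mem_filter.1 hq).2
      simp only at hxy hng hbl
      by_cases hUV : P.part x = P.part y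
      · refine Finset.mem_union_left _ (Finset.mem_union_left _ (Finset.mem_union_left _ ?_))
        refine Finset.mem_biUnion.2 ⟨P.part x, hpm x, ?_⟩
        rw [Finset.mem_offDiag]
        exact ⟨hpx x, hUV ▸ hpx y, hxy⟩
      by_cases hu : (sg G).IsUniform εr (P.part x) (P.part y)
      swap
      · refine Finset.mem_union_left _ (Finset.mem_union_left _ (Finset.mem_union_right _ ?_))
        refine Finset.mem_biUnion.2 ⟨(P.part x, P.part y), ?_, ?_⟩
        · rw [Finpartition.mk_mem_nonUniforms]
          exact ⟨hpm x, hpm y, hUV, hu⟩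
        · exact Finset.mem_product.2 ⟨hpx _, hpx _⟩
      by_cases hlow : d (P.part x) (P.part y) < δ
      · refine Finset.mem_union_left _ (Finset.mem_union_right _ ?_)
        refine Finset.mem_biUnion.2 ⟨(P.part x, P.part y), ?_, ?_⟩
        · rw [Finpartition.mk_mem_sparsePairs]
          exact ⟨hpm x, hpm y, hUV, hlow⟩
        · have hnb : ¬ black (P.part x) (P.part y) := by
            simp only [black]; linarith
          rw [SimpleGraph.mk_mem_interedges_iff]
          refine ⟨hpx x, hpx y, hxy, ?_⟩
          by_contra hc
          exact hbl ⟨fun h => absurd h hc, fun h => absurd h hnb⟩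
      · refine Finset.mem_union_right _ ?_
        have hhigh : 1 - δ < d (P.part x) (P.part y) := by
          by_contra hc
          exact hng ⟨hUV, hu, not_lt.1 hlow, not_lt.1 hc⟩
        have hsum := (sg G).edgeDensity_add_edgeDensity_compl (P.nonempty_of_mem_parts (hpm x))
          (P.nonempty_of_mem_parts (hpm y)) (P.disjoint (hpm x) (hpm y) hUV)
        have hsum' : d (P.part x) (P.part y) + ((sg G)ᶜ.edgeDensity (P.part x) (P.part y) : ℝ) = 1 := by
          simp only [d]; exact_mod_cast hsum
        refine Finset.mem_biUnion.2 ⟨(P.part x, P.part y), ?_, ?_⟩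
        · rw [Finpartition.mk_mem_sparsePairs]
          exact ⟨hpm x, hpm y, hUV, by linarith⟩
        · have hb : black (P.part x) (P.part y) := by
            simp only [black]; linarith
          rw [SimpleGraph.mk_mem_interedges_iff]
          refine ⟨hpx x, hpx y, ?_⟩
          rw [SimpleGraph.compl_adj]
          exact ⟨hxy, fun hc => hbl ⟨fun _ => hb, fun _ => hc.2⟩⟩
    have h1 := Finset.card_le_card hsub
    have hne : (univ : Finset (Fin n)).Nonempty := ⟨⟨0, hn1⟩, mem_univ _⟩
    have e1 := hPe.card_biUnion_offDiag_le hr0 (hl0.trans (by rw [← hk]; exact_mod_cast hkl0))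
    have e2 := hPe.sum_nonUniforms_lt hne hr0 hPu
    have e3 := hPe.card_interedges_sparsePairs_le (G := sg G) hδ0.le
    have e4 := hPe.card_interedges_sparsePairs_le (G := (sg G)ᶜ) hδ0.le
    rw [Finset.card_univ, Fintype.card_fin] at e1 e2 e3 e4
    have h2 := h1.trans ((Finset.card_union_le _ _).trans (Nat.add_le_add_right
      ((Finset.card_union_le _ _).trans (Nat.add_le_add_right (Finset.card_union_le _ _) _)) _))
    have h3 : ((univ.filter (fun q : Fin n × Fin n => q.1 ≠ q.2 ∧ ¬ gray (P.part q.1) (P.part q.2) ∧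
          ¬ (({q.1, q.2} : Finset (Fin n)) ∈ G ↔ black (P.part q.1) (P.part q.2)))).card : ℝ) ≤
      ((P.parts.biUnion offDiag).card : ℝ) + ((P.nonUniforms (sg G) εr).biUnion fun q => q.1 ×ˢ q.2).card +
        ((P.sparsePairs (sg G) δ).biUnion fun q => (sg G).interedges q.1 q.2).card +
        ((P.sparsePairs (sg G)ᶜ δ).biUnion fun q => (sg G)ᶜ.interedges q.1 q.2).card := by
      exact_mod_cast h2
    refine h3.trans ?_
    have hn2 : (0:ℝ) ≤ (n:ℝ) ^ 2 := by positivity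
    have f1 : εr * (n:ℝ)^2 ≤ ε / 16 * (n:ℝ)^2 := by gcongr
    have f2 : δ * (n:ℝ)^2 ≤ ε / 16 * (n:ℝ)^2 := by gcongr
    have f3 : 0 ≤ ε * (n:ℝ)^2 := by positivity
    linarith

def pairsOf {n : ℕ} (R : Fin n → Fin n → Prop) [DecidableRel R] : Finset (Finset (Fin n)) :=
  (univ.filter (fun q : Fin n × Fin n => q.1 ≠ q.2 ∧ R q.1 q.2)).image (fun q => {q.1, q.2})

theorem mem_pairsOf {n : ℕ} (R : Fin n → Fin n → Prop) [DecidableRel R]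
    (hs : ∀ x y, R x y → R y x) (x y : Fin n) :
    ({x, y} : Finset (Fin n)) ∈ pairsOf R ↔ x ≠ y ∧ R x y := by
  unfold pairsOf
  simp only [mem_image, mem_filter, mem_univ, true_and, Prod.exists]
  constructor
  · rintro ⟨a, b, ⟨hab, hR⟩, he⟩
    have ha : a ∈ ({x, y} : Finset (Fin n)) := by rw [← he]; simp
    have hb : b ∈ ({x, y} : Finset (Fin n)) := by rw [← he]; simp
    simp only [mem_insert, mem_singleton] at ha hb
    rcases ha with rfl | rfl <;> rcases hb with rfl | rfl
    · exact absurd rfl hab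
    · exact ⟨hab, hR⟩
    · exact ⟨hab.symm, hs _ _ hR⟩
    · exact absurd rfl hab
  · rintro ⟨h1, h2⟩
    exact ⟨x, y, ⟨h1, h2⟩, rfl⟩

theorem two_mul_card_pairsOf {n : ℕ} (R : Fin n → Fin n → Prop) [DecidableRel R]
    (hs : ∀ x y, R x y → R y x) :
    2 * (pairsOf R).card ≤ (univ.filter (fun q : Fin n × Fin n => q.1 ≠ q.2 ∧ R q.1 q.2)).card := by
  rw [Finset.card_eq_sum_card_image (fun q : Fin n × Fin n => ({q.1, q.2} : Finset (Fin n)))]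
  rw [mul_comm, ← smul_eq_mul]
  apply Finset.card_nsmul_le_sum
  intro e he
  obtain ⟨⟨x, y⟩, hq, rfl⟩ := mem_image.1 he
  simp only [mem_filter, mem_univ, true_and] at hq
  have : ({(x, y), (y, x)} : Finset (Fin n × Fin n)).card = 2 := by
    apply card_pair
    intro h
    exact hq.1 (congrArg Prod.fst h)
  rw [← this]
  apply card_le_card
  intro q hq'
  simp only [mem_insert, mem_singleton] at hq'
  simp only [mem_filter, mem_univ, true_and]
  rcases hq' with rfl | rfl
  · exact ⟨hq, rfl⟩
  · exact ⟨⟨hq.1.symm, hs _ _ hq.2⟩, Finset.pair_comm _ _⟩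

theorem mem_edgeUniv_two {n : ℕ} (e : Finset (Fin n)) :
    e ∈ edgeUniv 2 n ↔ ∃ x y, x ≠ y ∧ e = {x, y} := by
  simp [edgeUniv, mem_powersetCard, Finset.card_eq_two]

theorem small_subsets {α : Type*} [DecidableEq α] (U : Finset α) (d : ℕ) (x : ℝ) (h0 : 0 < x)
    (h1 : x ≤ 1) :
    ((U.powerset.filter (fun S => S.card ≤ d)).card : ℝ) * x ^ d ≤ (1 + x) ^ U.card := by
  have h2 : ∑ S ∈ U.powerset, x ^ S.card = (1 + x) ^ U.card := by
    have := Finset.sum_pow_mul_eq_add_pow x 1 U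
    simp only [one_pow, mul_one] at this
    rw [this, add_comm]
  rw [← h2, ← nsmul_eq_mul]
  calc _ ≤ ∑ S ∈ U.powerset.filter (fun S => S.card ≤ d), x ^ S.card := by
        apply Finset.card_nsmul_le_sum
        intro S hS
        exact pow_le_pow_of_le_one h0.le h1 (mem_filter.1 hS).2
    _ ≤ _ := by
        apply Finset.sum_le_sum_of_subset_of_nonneg (filter_subset _ _)
        intros; positivity

theorem prop_help1 {g e b c : Prop} (hc : c)
    (h : (g ∧ ¬ (c ∧ b) ∨ (c ∧ b) ∧ ¬ g) ∧ ¬ (c ∧ e)) : ¬ e ∧ ¬ (g ↔ b) := by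
  tauto

theorem prop_help2 {g e b : Prop} :
    (g ∧ e ∨ (((g ∧ ¬ b ∨ b ∧ ¬ g) ∧ ¬ e) ∧ ¬ b ∨ b ∧ ¬ ((g ∧ ¬ b ∨ b ∧ ¬ g) ∧ ¬ e)) ∧ ¬ e) ↔ g := by
  tauto

theorem count_upper {n K a d : ℕ} (A : Finset (Finset (Finset (Fin n))))
    (hA : ∀ G ∈ A, IsRGraph 2 n G ∧
      ∃ (p : Fin n → Fin K) (gr bl : Finset (Fin K × Fin K)),
    (∀ x y, (p x, p y) ∈ gr → (p y, p x) ∈ gr) ∧ (∀ x y, (p x, p y) ∈ bl → (p y, p x) ∈ bl) ∧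
    (univ.filter (fun q : Fin n × Fin n => (p q.1, p q.2) ∈ gr)).card ≤ 2 * a + 1 ∧
    (univ.filter (fun q : Fin n × Fin n => q.1 ≠ q.2 ∧ (p q.1, p q.2) ∉ gr ∧
      ¬ (({q.1, q.2} : Finset (Fin n)) ∈ G ↔ (p q.1, p q.2) ∈ bl))).card ≤ 2 * d + 1) :
    A.card ≤ (K ^ n * 2 ^ (K * K) * 2 ^ (K * K)) *
      (2 ^ a * ((edgeUniv 2 n).powerset.filter (fun S => S.card ≤ d)).card) := by
  classical
  let E : (Fin n → Fin K) × Finset (Fin K × Fin K) × Finset (Fin K × Fin K) →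
    Finset (Finset (Fin n)) := fun D => pairsOf (fun x y => (D.1 x, D.1 y) ∈ D.2.1)
  let B : (Fin n → Fin K) × Finset (Fin K × Fin K) × Finset (Fin K × Fin K) →
    Finset (Finset (Fin n)) := fun D => pairsOf (fun x y => (D.1 x, D.1 y) ∈ D.2.2)
  let Sm := (edgeUniv 2 n).powerset.filter (fun S => S.card ≤ d)
  have hsub : A ⊆ (univ.filter (fun D => (E D).card ≤ a)).biUnion (fun D =>
      ((E D).powerset ×ˢ Sm).image (fun q => q.1 ∪ (symmDiff q.2 (B D) \ E D))) := by
    intro G hG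
    obtain ⟨hG2, p, gr, bl, hgs, hbs, hgc, hbc⟩ := hA G hG
    rw [mem_biUnion]
    refine ⟨(p, gr, bl), ?_, ?_⟩
    · rw [mem_filter]
      refine ⟨mem_univ _, ?_⟩
      have h1 := two_mul_card_pairsOf (fun x y => (p x, p y) ∈ gr) hgs
      have h2 : (univ.filter (fun q : Fin n × Fin n => q.1 ≠ q.2 ∧ (p q.1, p q.2) ∈ gr)).card ≤
          (univ.filter (fun q : Fin n × Fin n => (p q.1, p q.2) ∈ gr)).card := by
        apply card_le_card
        intro q hq
        simp only [mem_filter] at hq ⊢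
        exact ⟨hq.1, hq.2.2⟩
      change (pairsOf (fun x y => (p x, p y) ∈ gr)).card ≤ a
      omega
    · rw [mem_image]
      refine ⟨(G ∩ E (p, gr, bl), symmDiff G (B (p, gr, bl)) \ E (p, gr, bl)), ?_, ?_⟩
      · rw [mem_product]
        refine ⟨mem_powerset.2 inter_subset_right, ?_⟩
        let R : Fin n → Fin n → Prop := fun x y => (p x, p y) ∉ gr ∧
          ¬ (({x, y} : Finset (Fin n)) ∈ G ↔ (p x, p y) ∈ bl)
        have hRs : ∀ x y, R x y → R y x := by
          rintro x y ⟨h1, h2⟩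
          refine ⟨fun h => h1 (hgs _ _ h), ?_⟩
          rw [Finset.pair_comm]
          intro h
          exact h2 (h.trans ⟨hbs _ _, hbs _ _⟩)
        have hss : symmDiff G (B (p, gr, bl)) \ E (p, gr, bl) ⊆ pairsOf R := by
          intro e he
          rw [mem_sdiff, mem_symmDiff] at he
          have hxy : ∃ x y, x ≠ y ∧ e = {x, y} := by
            rcases he.1 with h | h
            · exact (mem_edgeUniv_two e).1 (hG2 h.1)
            · obtain ⟨⟨x, y⟩, hq, rfl⟩ := mem_image.1 h.1
              exact ⟨x, y, (mem_filter.1 hq).2.1, rfl⟩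
          obtain ⟨x, y, hne, rfl⟩ := hxy
          have e1 : ({x, y} : Finset (Fin n)) ∈ E (p, gr, bl) ↔ x ≠ y ∧ (p x, p y) ∈ gr :=
            mem_pairsOf (fun x y => (p x, p y) ∈ gr) hgs x y
          have e2 : ({x, y} : Finset (Fin n)) ∈ B (p, gr, bl) ↔ x ≠ y ∧ (p x, p y) ∈ bl :=
            mem_pairsOf (fun x y => (p x, p y) ∈ bl) hbs x y
          rw [e1, e2] at he
          rw [mem_pairsOf R hRs]
          exact ⟨hne, prop_help1 hne he⟩
        have h1 := two_mul_card_pairsOf R hRs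
        have h2 := card_le_card hss
        rw [mem_filter, mem_powerset]
        constructor
        · intro e he
          obtain ⟨⟨x, y⟩, hq, rfl⟩ := mem_image.1 (hss he)
          exact (mem_edgeUniv_two _).2 ⟨x, y, (mem_filter.1 hq).2.1, rfl⟩
        · have h3 : (univ.filter (fun q : Fin n × Fin n => q.1 ≠ q.2 ∧ R q.1 q.2)).card ≤ 2 * d + 1 := by
            convert hbc
          change (symmDiff G (B (p, gr, bl)) \ E (p, gr, bl)).card ≤ d
          omega
      · ext e
        simp only [mem_union, mem_inter, mem_sdiff, mem_symmDiff]
        exact prop_help2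
  have hc : ∀ D ∈ (univ.filter (fun D => (E D).card ≤ a)),
      (((E D).powerset ×ˢ Sm).image (fun q => q.1 ∪ (symmDiff q.2 (B D) \ E D))).card ≤
      2 ^ a * Sm.card := by
    intro D hD
    refine card_image_le.trans ?_
    rw [card_product, card_powerset]
    exact Nat.mul_le_mul_right _ (Nat.pow_le_pow_right (by norm_num) (mem_filter.1 hD).2)
  refine (card_le_card hsub).trans ((card_biUnion_le_card_mul _ _ _ hc).trans ?_)
  refine Nat.mul_le_mul_right _ ((card_le_univ _).trans ?_)
  simp [mul_assoc]

theorem within_count (n t : ℕ) (ht : 1 ≤ t) :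
    t * (pairsOf (fun x y : Fin n => (x : ℕ) % t = (y : ℕ) % t)).card ≤ (edgeUniv 2 n).card := by
  classical
  let Wo := univ.filter (fun q : Fin n × Fin n => q.1 < q.2 ∧ (q.1 : ℕ) % t = (q.2 : ℕ) % t)
  let Po := univ.filter (fun q : Fin n × Fin n => q.1 < q.2)
  have h1 : (pairsOf (fun x y : Fin n => (x : ℕ) % t = (y : ℕ) % t)).card ≤ Wo.card := by
    refine le_trans (card_le_card ?_) (card_image_le (s := Wo)
      (f := fun q : Fin n × Fin n => ({q.1, q.2} : Finset (Fin n))))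
    intro e he
    obtain ⟨⟨x, y⟩, hq, rfl⟩ := mem_image.1 he
    simp only [mem_filter, mem_univ, true_and] at hq
    rw [mem_image]
    rcases lt_or_gt_of_ne hq.1 with h | h
    · exact ⟨(x, y), by simp [Wo, h, hq.2], rfl⟩
    · exact ⟨(y, x), by simp [Wo, h, hq.2], Finset.pair_comm _ _⟩
  have hkey : ∀ q ∈ Wo, ∀ c < t, (q.1 : ℕ) + c < q.2 := by
    intro q hq c hc
    simp only [Wo, mem_filter, mem_univ, true_and] at hq
    have h : t ∣ (q.2 : ℕ) - q.1 := (Nat.modEq_iff_dvd' (by have := hq.1; omega)).1 hq.2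
    have := Nat.le_of_dvd (by have := hq.1; omega) h
    omega
  have h2 : (Wo ×ˢ range t).card ≤ Po.card := by
    apply card_le_card_of_forall_subsingleton
      (fun (a : (Fin n × Fin n) × ℕ) (b : Fin n × Fin n) => (b.1 : ℕ) = a.1.1 + a.2 ∧ b.2 = a.1.2)
    · rintro ⟨q, c⟩ ha
      rw [mem_product, mem_range] at ha
      have := hkey q ha.1 c ha.2
      refine ⟨(⟨q.1 + c, this.trans q.2.isLt⟩, q.2), ?_, rfl, rfl⟩
      simp only [Po, mem_filter, mem_univ, true_and]
      exact this
    · rintro ⟨z, y⟩ hz ⟨⟨x, y1⟩, c⟩ ⟨ha, ha1, ha2⟩ ⟨⟨x', y2⟩, c'⟩ ⟨hb, hb1, hb2⟩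
      simp only at ha1 ha2 hb1 hb2
      subst ha2 hb2
      simp only [Wo, mem_product, mem_filter, mem_univ, true_and, mem_range] at ha hb
      have hm : (x : ℕ) ≡ x' [MOD t] := ha.1.2.trans hb.1.2.symm
      have hs : (x : ℕ) + c ≡ x' + c' [MOD t] := by rw [← ha1, ← hb1]
      have hc := Nat.ModEq.eq_of_lt_of_lt (Nat.ModEq.add_left_cancel hm hs) ha.2 hb.2
      subst hc
      have : x = x' := Fin.ext (by omega)
      rw [this]
  have h3 : Po.card ≤ (edgeUniv 2 n).card := by
    apply card_le_card_of_injOn (fun q => ({q.1, q.2} : Finset (Fin n)))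
    · intro q hq
      simp only [Po, coe_filter, mem_univ, true_and, Set.mem_setOf_eq] at hq
      exact (mem_edgeUniv_two _).2 ⟨q.1, q.2, hq.ne, rfl⟩
    · rintro ⟨x, y⟩ hq ⟨x', y'⟩ hq' he
      simp only [Po, coe_filter, mem_univ, true_and, Set.mem_setOf_eq] at hq hq' he
      have hx : x ∈ ({x', y'} : Finset (Fin n)) := by rw [← he]; simp
      have hy : y ∈ ({x', y'} : Finset (Fin n)) := by rw [← he]; simp
      simp only [mem_insert, mem_singleton] at hx hy
      rcases hx with rfl | rfl <;> rcases hy with rfl | rfl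
      · exact absurd hq (lt_irrefl _)
      · rfl
      · exact absurd (hq.trans hq') (lt_irrefl _)
      · exact absurd hq (lt_irrefl _)
  rw [card_product, card_range] at h2
  calc _ ≤ t * Wo.card := Nat.mul_le_mul_left _ h1
    _ ≤ _ := by rw [mul_comm]; exact h2.trans h3

open Classical in
theorem count_lower (v : ℕ) (F : Finset (Finset (Fin v))) (t s n : ℕ) (ht : 1 ≤ t) (hst : s ≤ t)
    (hns : ¬ CanPart v F s t) :
    ∃ w : ℕ, t * w ≤ (edgeUniv 2 n).card ∧ 2 ^ ((edgeUniv 2 n).card - w) ≤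
      ((edgeUniv 2 n).powerset.filter (fun G => IsRGraph 2 n G ∧
        ∀ U : Finset (Fin n), ¬ IsInducedCopyAt 2 v n F G U)).card := by
  let RW : Fin n → Fin n → Prop := fun x y => (x : ℕ) % t = (y : ℕ) % t
  have hRW : ∀ x y, RW x y → RW y x := fun x y h => Eq.symm h
  let RC : Fin n → Fin n → Prop := fun x y => (x : ℕ) % t = (y : ℕ) % t ∧ (x : ℕ) % t < s
  have hRC : ∀ x y, RC x y → RC y x := fun x y h => ⟨h.1.symm, h.1 ▸ h.2⟩
  have hWU : pairsOf RW ⊆ edgeUniv 2 n := by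
    intro e he
    obtain ⟨⟨x, y⟩, hq, rfl⟩ := mem_image.1 he
    exact (mem_edgeUniv_two _).2 ⟨x, y, (mem_filter.1 hq).2.1, rfl⟩
  have hCW : pairsOf RC ⊆ pairsOf RW := by
    intro e he
    obtain ⟨⟨x, y⟩, hq, rfl⟩ := mem_image.1 he
    rw [mem_filter] at hq
    exact (mem_pairsOf RW hRW x y).2 ⟨hq.2.1, hq.2.2.1⟩
  refine ⟨(pairsOf RW).card, ?_, ?_⟩
  · convert within_count n t ht
  rw [← card_sdiff_of_subset hWU, ← card_powerset]
  apply card_le_card_of_injOn (fun S => S ∪ pairsOf RC)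
  · intro S hS
    rw [mem_coe, mem_powerset] at hS
    have hG : S ∪ pairsOf RC ⊆ edgeUniv 2 n :=
      union_subset (hS.trans sdiff_subset) (hCW.trans hWU)
    rw [mem_coe, mem_filter, mem_powerset]
    refine ⟨hG, hG, ?_⟩
    rintro U ⟨f, -, hf⟩
    apply hns
    refine ⟨hst, fun i => univ.filter (fun x => (f x : ℕ) % t = i), ?_, ?_, ?_⟩
    · intro x
      refine ⟨⟨(f x : ℕ) % t, Nat.mod_lt _ ht⟩, by simp, ?_⟩
      intro i hi
      simp only [mem_filter, mem_univ, true_and] at hi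
      exact Fin.ext hi.symm
    · intro i hi x hx y hy hne
      simp only [mem_filter, mem_univ, true_and] at hx hy
      rw [hf _ (card_pair hne), mem_union]
      right
      rw [map_insert, map_singleton, mem_pairsOf RC hRC]
      exact ⟨fun h => hne (f.injective h), hx.trans hy.symm, hx ▸ hi⟩
    · intro i hi x hx y hy hne
      simp only [mem_filter, mem_univ, true_and] at hx hy
      rw [hf _ (card_pair hne), mem_union, map_insert, map_singleton]
      rintro (h | h)
      · apply (mem_sdiff.1 (hS h)).2
        rw [mem_pairsOf RW hRW]
        exact ⟨fun h => hne (f.injective h), hx.trans hy.symm⟩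
      · rw [mem_pairsOf RC hRC] at h
        have := h.2.2
        omega
  · intro S hS S' hS' he
    rw [mem_coe, mem_powerset] at hS hS'
    have key : ∀ T, T ⊆ edgeUniv 2 n \ pairsOf RW → (T ∪ pairsOf RC) \ pairsOf RW = T := by
      intro T hT
      ext e
      rw [mem_sdiff, mem_union]
      constructor
      · rintro ⟨h | h, h'⟩
        · exact h
        · exact absurd (hCW h) h'
      · intro h
        exact ⟨Or.inl h, (mem_sdiff.1 (hT h)).2⟩
    rw [← key S hS, ← key S' hS']
    simp only at he
    rw [he]

open Classical in
theorem prG_half (n : ℕ) (A : Set (Finset (Finset (Fin n)))) :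
    prG 2 n (1 / 2) A =
      (((edgeUniv 2 n).powerset.filter (fun G => G ∈ A)).card : ℝ) * (1 / 2) ^ (n.choose 2) := by
  have hN : (edgeUniv 2 n).card = n.choose 2 := by simp [edgeUniv]
  unfold prG
  rw [card_filter, Nat.cast_sum, sum_mul]
  apply sum_congr rfl
  intro G hG
  by_cases h : G ∈ A
  · rw [Set.indicator_of_mem h, if_pos h]
    have := card_le_card (mem_powerset.1 hG)
    have e : (1 : ℝ) - 1 / 2 = 1 / 2 := by norm_num
    rw [e, ← pow_add, Nat.add_sub_cancel' this, hN]
    simp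
  · rw [Set.indicator_of_notMem h, if_neg h]
    simp

theorem floor_help (c : ℕ) (z : ℝ) (h : (c : ℝ) ≤ z) : c ≤ 2 * ⌊z / 2⌋₊ + 1 := by
  have h1 := Nat.lt_floor_add_one (z / 2)
  have h2 : (c : ℝ) < ((2 * ⌊z / 2⌋₊ + 2 : ℕ) : ℝ) := by
    push_cast
    linarith
  have : c < 2 * ⌊z / 2⌋₊ + 2 := by exact_mod_cast h2
  omega

set_option maxHeartbeats 1000000 in
open Classical in
theorem upper_final (v : ℕ) (F : Finset (Finset (Fin v))) (t : ℕ) (ht : 1 ≤ t)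
    (h : ∀ s ≤ t + 1, CanPart v F s (t + 1)) (γ : ℝ) (hγ : 0 < γ) :
    ∃ n1 : ℕ, ∀ n, n1 ≤ n →
      0 < ((edgeUniv 2 n).powerset.filter (fun G => IsRGraph 2 n G ∧
        ∀ U : Finset (Fin n), ¬ IsInducedCopyAt 2 v n F G U)).card →
      Real.logb 2 (((edgeUniv 2 n).powerset.filter (fun G => IsRGraph 2 n G ∧
        ∀ U : Finset (Fin n), ¬ IsInducedCopyAt 2 v n F G U)).card : ℝ) ≤
        (1 - 1 / (t : ℝ) + γ) * (n.choose 2 : ℝ) := by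
  obtain ⟨x, hx0, hx1, hxl⟩ : ∃ x : ℝ, 0 < x ∧ x ≤ 1 ∧ Real.logb 2 (1 + x) ≤ γ / 8 := by
    have hp : (1 : ℝ) < 2 ^ (γ / 8) := Real.one_lt_rpow (by norm_num) (by positivity)
    refine ⟨min 1 ((2 : ℝ) ^ (γ / 8) - 1), lt_min one_pos (by linarith), min_le_left _ _, ?_⟩
    have hpos : 0 < min 1 ((2 : ℝ) ^ (γ / 8) - 1) := lt_min one_pos (by linarith)
    rw [Real.logb_le_iff_le_rpow (by norm_num) (by linarith)]
    have := min_le_right 1 ((2 : ℝ) ^ (γ / 8) - 1)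
    linarith
  obtain ⟨M, hM⟩ : ∃ M, M = -Real.logb 2 x := ⟨_, rfl⟩
  have hM0 : 0 ≤ M := by
    have := Real.logb_nonpos (b := 2) (by norm_num) hx0.le hx1
    linarith
  obtain ⟨ε, hεd⟩ : ∃ ε, ε = γ / (8 * (1 + M)) := ⟨_, rfl⟩
  have hε : 0 < ε := by rw [hεd]; positivity
  have hεM : ε * (1 + M) = γ / 8 := by rw [hεd]; field_simp
  obtain ⟨K, n0, HS⟩ := structure_lemma v F t ht h ε hε
  have htr : (1 : ℝ) ≤ t := by exact_mod_cast ht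
  have hti : 1 / (t : ℝ) ≤ 1 := by rw [div_le_one (by linarith)]; exact htr
  have hti0 : 0 < 1 / (t : ℝ) := by positivity
  obtain ⟨C, hC⟩ : ∃ C, C = Real.logb 2 K + 1 / 2 + γ / 16 + 2 * (K : ℝ) * K := ⟨_, rfl⟩
  obtain ⟨m, hm⟩ := exists_nat_ge (1 + 8 * C / (3 * γ))
  refine ⟨max (max n0 m) 2, fun n hn hpos => ?_⟩
  have hn0 : n0 ≤ n := le_trans (le_trans (le_max_left _ _) (le_max_left _ _)) hn
  have hnm : m ≤ n := le_trans (le_trans (le_max_right _ _) (le_max_left _ _)) hn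
  have hn2 : 2 ≤ n := le_trans (le_max_right _ _) hn
  set A := (edgeUniv 2 n).powerset.filter (fun G => IsRGraph 2 n G ∧
        ∀ U : Finset (Fin n), ¬ IsInducedCopyAt 2 v n F G U) with hA
  obtain ⟨a, ha⟩ : ∃ a, a = ⌊((1 - 1 / (t : ℝ) + ε) * (n : ℝ) ^ 2) / 2⌋₊ := ⟨_, rfl⟩
  obtain ⟨d, hd⟩ : ∃ d, d = ⌊(ε * (n : ℝ) ^ 2) / 2⌋₊ := ⟨_, rfl⟩
  have hcnt := count_upper (K := K) (a := a) (d := d) A (by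
    intro G hG
    have hG' := (mem_filter.1 hG).2
    obtain ⟨p, gr, bl, h1, h2, -, h4, h5⟩ := HS n hn0 G hG'.2
    refine ⟨hG'.1, p, gr, bl, h1, h2, ?_, ?_⟩
    · rw [ha]; exact floor_help _ _ h4
    · rw [hd]
      refine floor_help _ _ ?_
      convert h5)
  have hN : (edgeUniv 2 n).card = n.choose 2 := by simp [edgeUniv]
  have hsm := small_subsets (edgeUniv 2 n) d x hx0 hx1
  rw [hN] at hsm
  set Sm := ((edgeUniv 2 n).powerset.filter (fun S => S.card ≤ d)).card with hSm
  have hSm' : (Sm : ℝ) ≤ (1 + x) ^ (n.choose 2) / x ^ d := by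
    rw [le_div_iff₀ (by positivity)]; convert hsm
  have hK : 0 < K := by
    rcases Nat.eq_zero_or_pos K with h0 | h0
    · exfalso
      have : A.card ≤ 0 := by
        refine hcnt.trans (le_of_eq ?_)
        rw [h0, zero_pow (by omega)]; simp
      omega
    · exact h0
  have hKr : (0 : ℝ) < K := by exact_mod_cast hK
  have hcntr : (A.card : ℝ) ≤ ((K : ℝ) ^ n * 2 ^ (K * K) * 2 ^ (K * K)) *
      (2 ^ a * ((1 + x) ^ (n.choose 2) / x ^ d)) := by
    have : (A.card : ℝ) ≤ ((K : ℝ) ^ n * 2 ^ (K * K) * 2 ^ (K * K)) * (2 ^ a * Sm) := by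
      exact_mod_cast hcnt
    refine this.trans ?_
    gcongr
  have hlog : Real.logb 2 A.card ≤ n * Real.logb 2 K + (K * K : ℕ) + (K * K : ℕ) +
      (a + ((n.choose 2 : ℕ) * Real.logb 2 (1 + x) + d * M)) := by
    refine (Real.logb_le_logb_of_le (by norm_num) (by exact_mod_cast hpos) hcntr).trans (le_of_eq ?_)
    rw [Real.logb_mul (by positivity) (by positivity), Real.logb_mul (by positivity) (by positivity),
      Real.logb_mul (by positivity) (by positivity), Real.logb_mul (by positivity) (by positivity),
      Real.logb_div (by positivity) (by positivity), Real.logb_pow, Real.logb_pow, Real.logb_pow,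
      Real.logb_pow, Real.logb_pow, Real.logb_self_eq_one (by norm_num), hM]
    ring
  have hnr : (2 : ℝ) ≤ n := by exact_mod_cast hn2
  have hNr : ((n.choose 2 : ℕ) : ℝ) = n * (n - 1) / 2 := Nat.cast_choose_two ℝ n
  have har : (a : ℝ) ≤ ((1 - 1 / (t : ℝ) + ε) * (n : ℝ) ^ 2) / 2 := by
    rw [ha]; apply Nat.floor_le
    have : 0 ≤ 1 - 1 / (t : ℝ) + ε := by linarith
    positivity
  have hdr : (d : ℝ) ≤ (ε * (n : ℝ) ^ 2) / 2 := by
    rw [hd]; exact Nat.floor_le (by positivity)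
  have hdM : (d : ℝ) * M ≤ (ε * (n : ℝ) ^ 2) / 2 * M := by gcongr
  have hmn : 1 + 8 * C / (3 * γ) ≤ (n : ℝ) := hm.trans (by exact_mod_cast hnm)
  have hCn : C ≤ 3 / 8 * γ * (n - 1) := by
    have : 8 * C / (3 * γ) ≤ n - 1 := by linarith
    rw [div_le_iff₀ (by positivity)] at this
    linarith
  have hCn' : n * C ≤ n * (3 / 8 * γ * (n - 1)) := mul_le_mul_of_nonneg_left hCn (by linarith)
  have hNl : ((n.choose 2 : ℕ) : ℝ) * Real.logb 2 (1 + x) ≤ (n.choose 2 : ℕ) * (γ / 8) := by gcongr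
  have hεε : (ε * (n : ℝ) ^ 2) / 2 * M + (ε * (n : ℝ) ^ 2) / 2 = γ / 16 * (n : ℝ) ^ 2 := by
    linear_combination ((n : ℝ) ^ 2 / 2) * hεM
  have hKK : (K : ℝ) * K ≤ n * (K * K) := by
    have : (0 : ℝ) ≤ K * K := by positivity
    nlinarith
  have htn : 0 ≤ (1 / (t : ℝ)) * n := by positivity
  push_cast at hlog
  rw [hC] at hCn'
  rw [hNr] at hlog hNl ⊢
  linarith [hlog, har, hdM, hCn', hNl, hεε, hKK, htn]

theorem zero_case (v : ℕ) (F : Finset (Finset (Fin v)))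
    (ht1 : ¬ CanPart v F 0 0) (ht2 : ∀ s ≤ 1, CanPart v F s 1) (n : ℕ) (hn : 1 ≤ n)
    (G : Finset (Finset (Fin n))) : ∃ U, IsInducedCopyAt 2 v n F G U := by
  have hv0 : v ≠ 0 := by
    rintro rfl
    apply ht1
    exact ⟨le_refl _, fun _ => ∅, fun x => x.elim0, fun i => i.elim0, fun i => i.elim0⟩
  have hv2 : v < 2 := by
    by_contra hv
    push Not at hv
    obtain ⟨-, P, hP, -, hI⟩ := ht2 0 (by norm_num)
    obtain ⟨-, Q, hQ, hC, -⟩ := ht2 1 le_rfl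
    have hPa : ∀ x, x ∈ P 0 := by
      intro x
      obtain ⟨i, hi, -⟩ := hP x
      have : i = 0 := Subsingleton.elim _ _
      simpa [this] using hi
    have hQa : ∀ x, x ∈ Q 0 := by
      intro x
      obtain ⟨i, hi, -⟩ := hQ x
      have : i = 0 := Subsingleton.elim _ _
      simpa [this] using hi
    have hne : (⟨0, by omega⟩ : Fin v) ≠ ⟨1, by omega⟩ := by simp
    exact hI 0 (by simp) _ (hPa _) _ (hPa _) hne (hC 0 (by simp) _ (hQa _) _ (hQa _) hne)
  have hv1 : v = 1 := by omega
  subst hv1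
  refine ⟨_, ⟨fun _ => ⟨0, hn⟩, fun a b _ => Subsingleton.elim a b⟩, rfl, ?_⟩
  intro e he
  have := card_le_univ e
  simp at this
  omega

/-- **Prömel–Steger.** Let `F` be a `2`-graph and `t` the maximum integer for which
there exists `s ≤ t` such that the vertices of `F` cannot be partitioned into `s`
cliques and `t - s` independent sets. Then `c(1/2,{F}) = 1/t`, i.e. the sequence `c_n`
with `Pr[G(n,1/2) ∈ Forb({F})ⁿ] = 2 ^ (-c_n C(n,2))` tends to `1/t`. -/
theorem stmt_13 (v : ℕ) (F : Finset (Finset (Fin v))) (hF : IsRGraph 2 v F)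
    (t : ℕ)
    (ht1 : ∃ s ≤ t, ¬ CanPart v F s t)
    (ht2 : ∀ t', t < t' → ∀ s ≤ t', CanPart v F s t') :
    Filter.Tendsto
      (fun n => -(Real.logb 2 (prG 2 n (1 / 2)
        {G : Finset (Finset (Fin n)) |
          IsRGraph 2 n G ∧ ∀ U : Finset (Fin n), ¬ IsInducedCopyAt 2 v n F G U})) /
        (n.choose 2 : ℝ))
      Filter.atTop (nhds (1 / (t : ℝ))) := by
  classical
  obtain ⟨s, hst, hns⟩ := ht1
  rcases Nat.eq_zero_or_pos t with h0 | hpos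
  · subst h0
    have hs0 : s = 0 := by omega
    subst hs0
    refine Filter.Tendsto.congr' ?_ tendsto_const_nhds
    filter_upwards [Filter.eventually_ge_atTop 1] with n hn
    have : {G : Finset (Finset (Fin n)) |
          IsRGraph 2 n G ∧ ∀ U : Finset (Fin n), ¬ IsInducedCopyAt 2 v n F G U} = ∅ := by
      apply Set.eq_empty_of_forall_notMem
      rintro G ⟨-, hG⟩
      obtain ⟨U, hU⟩ := zero_case v F hns (ht2 1 (by norm_num)) n hn G
      exact hG U hU
    rw [this]
    simp [prG]
  · rw [Metric.tendsto_atTop]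
    intro γ hγ
    obtain ⟨n1, hn1⟩ := upper_final v F t hpos (ht2 (t + 1) (by omega)) (γ / 2) (by positivity)
    refine ⟨max n1 2, fun n hn => ?_⟩
    have hU := hn1 n (le_trans (le_max_left _ _) hn)
    have hn2 : 2 ≤ n := le_trans (le_max_right _ _) hn
    obtain ⟨w, hw1, hw2⟩ := count_lower v F t s n hpos hst hns
    have hN : (edgeUniv 2 n).card = n.choose 2 := by simp [edgeUniv]
    rw [hN] at hw1 hw2
    have hp : prG 2 n (1 / 2) {G : Finset (Finset (Fin n)) |
          IsRGraph 2 n G ∧ ∀ U : Finset (Fin n), ¬ IsInducedCopyAt 2 v n F G U} =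
        (((edgeUniv 2 n).powerset.filter (fun G => IsRGraph 2 n G ∧
        ∀ U : Finset (Fin n), ¬ IsInducedCopyAt 2 v n F G U)).card : ℝ) * (1 / 2) ^ (n.choose 2) := by
      rw [prG_half]
      congr 2
      apply congrArg Finset.card
      ext G
      simp only [mem_filter, Set.mem_setOf_eq]
    rw [hp]
    generalize ((edgeUniv 2 n).powerset.filter (fun G => IsRGraph 2 n G ∧
        ∀ U : Finset (Fin n), ¬ IsInducedCopyAt 2 v n F G U)).card = c at hU hw2 ⊢
    have hc : 0 < c := lt_of_lt_of_le (by positivity) hw2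
    have hcr : (0 : ℝ) < c := by exact_mod_cast hc
    have hU' := hU hc
    have hNpos : 0 < n.choose 2 := Nat.choose_pos hn2
    generalize n.choose 2 = N at hU' hw1 hw2 hNpos ⊢
    have hNr : (0 : ℝ) < N := by exact_mod_cast hNpos
    have htr : (0 : ℝ) < t := by exact_mod_cast hpos
    have hwN : w ≤ N := le_trans (Nat.le_mul_of_pos_left w hpos) hw1
    have hL : (N : ℝ) - w ≤ Real.logb 2 c := by
      rw [Real.le_logb_iff_rpow_le (by norm_num) hcr, ← Nat.cast_sub hwN, Real.rpow_natCast]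
      exact_mod_cast hw2
    have hwt : (w : ℝ) ≤ 1 / (t : ℝ) * N := by
      rw [one_div, inv_mul_eq_div, le_div_iff₀ htr, mul_comm]
      exact_mod_cast hw1
    have hval : -(Real.logb 2 ((c : ℝ) * (1 / 2) ^ N)) / (N : ℝ) = 1 - Real.logb 2 c / N := by
      rw [Real.logb_mul hcr.ne' (by positivity), Real.logb_pow, one_div, Real.logb_inv,
        Real.logb_self_eq_one (by norm_num)]
      field_simp
      ring
    rw [hval, Real.dist_eq, abs_lt]
    have h1 : Real.logb 2 c / N ≤ 1 - 1 / (t : ℝ) + γ / 2 := by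
      rw [div_le_iff₀ hNr]; exact hU'
    have h2 : 1 - 1 / (t : ℝ) ≤ Real.logb 2 c / N := by
      rw [le_div_iff₀ hNr]; linarith
    constructor <;> linarith
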